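/- Let m ≥ 2 be an integer and let f: ℝ → ℝ be real and even with Fourier transform f̂ continuous and supported in [−2/m, 2/m]. For each N ≥ 1 define Z_f(U) := Σ_{|n| ≤ 2N/m} (1/N) f̂(n/N) Tr(U^n) on U(N). Then lim_{N→∞} ∫_{U(N)} (Z_f(U) − f̂(0))^m dμ_N(U) equals 0 if m is odd, and equals (m!/(2^{m/2}(m/2)!)) · σ^m if m is even, where σ² = ∫_{−1}^{1} |u| · f̂(u)² du. -/

import Mathlib

open MeasureTheory Filter

noncomputable instance (N : ℕ) : MeasurableSpace (Matrix.unitaryGroup (Fin N) ℂ) := borel _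

/-- The (finite) linear statistic `Z_f(U) = ∑_{|n| ≤ 2N/m} (1/N) f̂(n/N) Tr(U^n)` on `U(N)`. -/
noncomputable def Zfm (m N : ℕ) (fhat : ℝ → ℝ) (U : Matrix.unitaryGroup (Fin N) ℂ) : ℂ :=
  ∑ n ∈ Finset.Icc (-⌊2 * (N : ℝ) / m⌋) ⌊2 * (N : ℝ) / m⌋,
    (1 / N : ℂ) * (fhat ((n : ℝ) / N) : ℂ) *
      Matrix.trace ((U ^ n : Matrix.unitaryGroup (Fin N) ℂ) : Matrix (Fin N) (Fin N) ℂ)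

open MvPolynomial in
/-- The Schwinger–Dyson (loop) equations, together with the elementary symmetry properties, of the
functional sending a polynomial in the variables `X n` (`n : ℤ`) to the expectation of its value
at `X n = Tr (U ^ n)`, for a random unitary matrix `U` of size `N`. -/
structure IsLoopFunctional (N : ℕ) (E : MvPolynomial ℤ ℂ →ₗ[ℂ] ℂ) : Prop where
  map_X_zero_mul : ∀ P, E (X 0 * P) = N * E P
  loop : ∀ (n : ℤ) (s : ℤ →₀ ℕ) (T : Finset ℤ), 0 < n → s.support ⊆ T →
    N * E (X n * monomial s 1) + ∑ j ∈ Finset.Ioo 0 n, E (X j * (X (n - j) * monomial s 1)) +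
      ∑ k ∈ T, (k : ℂ) * E (X (n + k) * pderiv k (monomial s 1)) = 0
  norm_le : ∀ s : ℤ →₀ ℕ, ‖E (monomial s 1)‖ ≤ (N : ℝ) ^ s.degree
  eq_zero : ∀ s : ℤ →₀ ℕ, Finsupp.weight (id : ℤ → ℤ) s ≠ 0 → E (monomial s 1) = 0
  map_neg : ∀ s : ℤ →₀ ℕ, E (monomial (s.equivMapDomain (Equiv.neg ℤ)) 1) =
    starRingEnd ℂ (E (monomial s 1))

namespace IsLoopFunctional

open MvPolynomial

/-- The total of the positive indices of a monomial. -/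
noncomputable abbrev posWeight : (ℤ →₀ ℕ) →+ ℕ := Finsupp.weight fun k : ℤ => k.toNat

/-- The total of the negative indices of a monomial, in absolute value. -/
noncomputable abbrev negWeight : (ℤ →₀ ℕ) →+ ℕ := Finsupp.weight fun k : ℤ => (-k).toNat

/-- A weight depending only on the exponents at nonpositive indices. -/
noncomputable abbrev nonposWeight : (ℤ →₀ ℕ) →+ ℕ := Finsupp.weight fun k : ℤ => (1 - k).toNat

lemma weight_id_eq (s : ℤ →₀ ℕ) :
    Finsupp.weight (id : ℤ → ℤ) s = (posWeight s : ℤ) - negWeight s := by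
  simp only [posWeight, negWeight, Finsupp.weight_apply, Finsupp.sum]
  push_cast
  rw [← Finset.sum_sub_distrib]
  refine Finset.sum_congr rfl fun k _ => ?_
  have : (k : ℤ) = (k.toNat : ℤ) - ((-k).toNat : ℤ) := by omega
  simp only [nsmul_eq_mul, smul_eq_mul, id]
  push_cast
  rw [← mul_sub, ← this]

lemma weight_equivMapDomain_neg {M : Type*} [AddCommMonoid M] (w : ℤ → M) (s : ℤ →₀ ℕ) :
    Finsupp.weight w (s.equivMapDomain (Equiv.neg ℤ)) = Finsupp.weight (fun k => w (-k)) s := by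
  simp [Finsupp.weight_apply, Finsupp.sum_equivMapDomain]

lemma posWeight_neg (s : ℤ →₀ ℕ) :
    posWeight (s.equivMapDomain (Equiv.neg ℤ)) = negWeight s :=
  weight_equivMapDomain_neg _ _

lemma degree_le (s : ℤ →₀ ℕ) : s.degree ≤ posWeight s + nonposWeight s := by
  simp only [posWeight, nonposWeight, Finsupp.weight_apply, Finsupp.sum, Finsupp.degree_apply]
  rw [← Finset.sum_add_distrib]
  refine Finset.sum_le_sum fun k _ => ?_
  simp only [smul_eq_mul]
  rw [← mul_add]
  exact Nat.le_mul_of_pos_right _ (by omega)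

lemma X_mul_monomial (n : ℤ) (s : ℤ →₀ ℕ) :
    (X n * monomial s 1 : MvPolynomial ℤ ℂ) = monomial (Finsupp.single n 1 + s) 1 := by
  simp [X, monomial_mul]

lemma weight_sub_single {w : ℤ → ℕ} {s : ℤ →₀ ℕ} {k : ℤ} (hk : s k ≠ 0) :
    Finsupp.weight w (s - Finsupp.single k 1) + w k = Finsupp.weight w s :=
  Finsupp.weight_sub_single_add hk

lemma pderiv_monomial_one (k : ℤ) (s : ℤ →₀ ℕ) :
    pderiv k (monomial s (1 : ℂ)) = (s k : ℂ) • monomial (s - Finsupp.single k 1) 1 := by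
  rw [pderiv_monomial, smul_monomial]; simp

lemma pderiv_comm' (i j : ℤ) (s : ℤ →₀ ℕ) :
    pderiv i (pderiv j (monomial s (1 : ℂ))) = pderiv j (pderiv i (monomial s 1)) := by
  have h : (⁅(pderiv i : Derivation ℂ (MvPolynomial ℤ ℂ) (MvPolynomial ℤ ℂ)),
      (pderiv j : Derivation ℂ (MvPolynomial ℤ ℂ) (MvPolynomial ℤ ℂ))⁆ :
      Derivation ℂ (MvPolynomial ℤ ℂ) (MvPolynomial ℤ ℂ)) = 0 := by
    ext k
    simp [Derivation.commutator_apply, pderiv_X, Pi.single_apply]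
    split_ifs <;> simp
  have := congrArg (fun D => D (monomial s (1 : ℂ))) h
  simpa [Derivation.commutator_apply, sub_eq_zero] using this

variable {N : ℕ} {E : MvPolynomial ℤ ℂ →ₗ[ℂ] ℂ}

/-- The failure of the Wick identity for the variable `X n`. -/
noncomputable def wickError (E : MvPolynomial ℤ ℂ →ₗ[ℂ] ℂ) (n : ℤ) (P : MvPolynomial ℤ ℂ) : ℂ :=
  E (X n * P) - n * E (pderiv (-n) P)

lemma norm_wickError_le (hE : IsLoopFunctional N E) (hN : 1 ≤ N) {n : ℤ} (hn : 0 < n)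
    (s : ℤ →₀ ℕ) :
    ‖wickError E n (monomial s 1)‖ ≤
      (1 + (n.toNat + posWeight s) * (posWeight s + nonposWeight s)) *
        (N : ℝ) ^ (1 + posWeight s + nonposWeight s) := by
  have hN' : (1 : ℝ) ≤ N := by exact_mod_cast hN
  have hd := degree_le s
  unfold wickError
  rw [X_mul_monomial, pderiv_monomial_one, map_smul]
  refine (norm_sub_le _ _).trans ?_
  have h1 : ‖E (monomial (Finsupp.single n 1 + s) 1)‖ ≤
      (N : ℝ) ^ (1 + posWeight s + nonposWeight s) := by
    refine (hE.norm_le _).trans (pow_le_pow_right₀ hN' ?_)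
    rw [map_add, Finsupp.degree_single]; omega
  have h2 : ‖E (monomial (s - Finsupp.single (-n) 1) 1)‖ ≤
      (N : ℝ) ^ (1 + posWeight s + nonposWeight s) := by
    refine (hE.norm_le _).trans (pow_le_pow_right₀ hN' ?_)
    have := Finsupp.degree_mono (show s - Finsupp.single (-n) 1 ≤ s from tsub_le_self)
    omega
  have h3 : (s (-n) : ℝ) ≤ posWeight s + nonposWeight s := by
    have : s (-n) ≤ s.degree := Finsupp.le_degree _ _
    exact_mod_cast this.trans hd
  have h4 : ‖(n : ℂ)‖ ≤ n.toNat + posWeight s := by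
    have : (n : ℂ) = ((n.toNat : ℕ) : ℂ) := by
      rw [← Int.cast_natCast, Int.toNat_of_nonneg hn.le]
    rw [this, Complex.norm_natCast]
    exact le_add_of_nonneg_right (by positivity)
  rw [norm_mul, norm_smul, Complex.norm_natCast, add_mul, one_mul]
  refine add_le_add h1 ?_
  rw [mul_assoc]
  gcongr

/-- Algebraic core: the loop equation in terms of the Wick errors, once the Wick identity holds
for the negative indices. -/
lemma loop_wickError (hE : IsLoopFunctional N E) {n : ℤ} (hn : 0 < n) (s : ℤ →₀ ℕ)
    (hneg : ∀ l : ℤ, l < 0 → ∀ k : ℤ,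
      E (X l * pderiv k (monomial s 1)) = -l * E (pderiv (-l) (pderiv k (monomial s 1)))) 
    (B : ℕ) (hB : ∀ k ∈ s.support, |k| ≤ B) :
    N * wickError E n (monomial s 1) +
      ∑ j ∈ Finset.Ioo 0 n, wickError E j (X (n - j) * monomial s 1) +
      ∑ k ∈ Finset.Ioc (0 : ℤ) B, (k : ℂ) * wickError E (n + k) (pderiv k (monomial s 1)) = 0 := by
  set T : Finset ℤ := Finset.Icc (-n - B) B with hT
  have hsub : s.support ⊆ T := fun k hk => by
    have := abs_le.1 (hB k hk)
    rw [hT, Finset.mem_Icc]; omega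
  have hloop := hE.loop n s T hn hsub
  set P : MvPolynomial ℤ ℂ := monomial s 1 with hP
  let H : ℤ → ℂ := fun k => k * (n + k) * E (pderiv (-(n + k)) (pderiv k P))
  have hH : ∀ k, H (-n - k) = H k := fun k => by
    simp only [H]
    rw [show -(n + (-n - k)) = k by ring, pderiv_comm', show -n - k = -(n + k) by ring]
    push_cast
    ring
  have hsym : ∑ k ∈ T with 0 < k, H k = ∑ k ∈ T with k < -n, H k := by
    refine Finset.sum_nbij' (fun k => -n - k) (fun k => -n - k) ?_ ?_ ?_ ?_ ?_
    · intro k hk; simp only [hT, Finset.mem_filter, Finset.mem_Icc] at hk ⊢; omega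
    · intro k hk; simp only [hT, Finset.mem_filter, Finset.mem_Icc] at hk ⊢; omega
    · intro k _; ring
    · intro k _; ring
    · intro k _; exact (hH k).symm
  have hj : ∀ j ∈ Finset.Ioo 0 n, E (X j * (X (n - j) * P)) =
      wickError E j (X (n - j) * P) + j * E (X (n - j) * pderiv (-j) P) := by
    intro j hj
    rw [Finset.mem_Ioo] at hj
    rw [wickError, pderiv_mul, pderiv_X_of_ne (by omega : n - j ≠ -j)]
    simp
  have hk : ∀ k : ℤ, (k : ℂ) * E (X (n + k) * pderiv k P) =
      (if 0 < k then k * wickError E (n + k) (pderiv k P) else 0) +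
      ((if 0 < k then H k else 0) - (if k < -n then H k else 0)) +
      (if -n < k ∧ k < 0 then (k : ℂ) * E (X (n + k) * pderiv k P) else 0) +
      (if k = -n then -(n * N * E (pderiv (-n) P)) else 0) := by
    intro k
    rcases lt_trichotomy k (-n) with h | h | h
    · rw [if_neg (by omega), if_neg (by omega), if_pos h, if_neg (by omega), if_neg (by omega),
        hneg _ (by omega)]
      simp only [H]; push_cast; ring
    · subst h
      rw [if_neg (by omega), if_neg (by omega), if_neg (by omega), if_neg (by omega), if_pos rfl]
      rw [show n + -n = 0 by ring, hE.map_X_zero_mul]; push_cast; ring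
    · rcases lt_trichotomy k 0 with h' | h' | h'
      · rw [if_neg (by omega), if_neg (by omega), if_neg (by omega), if_pos ⟨h, h'⟩,
          if_neg (by omega)]; ring
      · subst h'
        simp [hn.not_gt, hn.ne']
      · rw [if_pos h', if_pos h', if_neg (by omega), if_neg (by omega), if_neg (by omega)]
        simp only [H, wickError]; push_cast; ring
  have hmid : ∑ k ∈ T with -n < k ∧ k < 0, (k : ℂ) * E (X (n + k) * pderiv k P) =
      - ∑ j ∈ Finset.Ioo 0 n, (j : ℂ) * E (X (n - j) * pderiv (-j) P) := by
    rw [← Finset.sum_neg_distrib]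
    refine Finset.sum_nbij' (fun k => -k) (fun k => -k) ?_ ?_ ?_ ?_ ?_
    · intro k hk; simp only [hT, Finset.mem_filter, Finset.mem_Icc, Finset.mem_Ioo] at hk ⊢; omega
    · intro k hk; simp only [hT, Finset.mem_filter, Finset.mem_Icc, Finset.mem_Ioo] at hk ⊢; omega
    · intro k _; ring
    · intro k _; ring
    · intro k _; simp
  have hone : ∑ k ∈ T, (if k = -n then -((n : ℂ) * N * E (pderiv (-n) P)) else 0) =
      -((n : ℂ) * N * E (pderiv (-n) P)) := by
    rw [Finset.sum_ite_eq', if_pos]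
    simp only [hT, Finset.mem_Icc]; omega
  have hpos : (T.filter fun k => 0 < k) = Finset.Ioc (0 : ℤ) B := by
    ext k; simp only [hT, Finset.mem_filter, Finset.mem_Icc, Finset.mem_Ioc]; omega
  rw [Finset.sum_congr rfl hj, Finset.sum_congr rfl fun k _ => hk k] at hloop
  simp only [Finset.sum_add_distrib, Finset.sum_sub_distrib, ← Finset.sum_filter] at hloop
  rw [hsym, hmid, hpos] at hloop
  rw [Finset.sum_filter (fun k => k = -n), hone] at hloop
  rw [← hloop]
  simp only [wickError]
  ring

lemma posWeight_eq_sum (s : ℤ →₀ ℕ) (B : ℕ) (hB : ∀ k ∈ s.support, |k| ≤ B) :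
    (posWeight s : ℝ) = ∑ k ∈ Finset.Ioc (0 : ℤ) B, (k : ℝ) * s k := by
  have h1 : (posWeight s : ℝ) = ∑ k ∈ s.support, (s k : ℝ) * (k.toNat : ℝ) := by
    simp [posWeight, Finsupp.weight_apply, Finsupp.sum]
  have h2 : s.support ⊆ Finset.Icc (-B : ℤ) B := fun k hk => by
    rw [Finset.mem_Icc]; exact abs_le.1 (hB k hk)
  rw [h1, Finset.sum_subset h2 fun k _ hk => by simp [Finsupp.notMem_support_iff.1 hk]]
  symm
  refine Finset.sum_subset_zero_on_sdiff (fun k hk => ?_) (fun k hk => ?_) (fun k hk => ?_)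
  · simp only [Finset.mem_Icc, Finset.mem_Ioc] at hk ⊢; omega
  · simp only [Finset.mem_sdiff, Finset.mem_Icc, Finset.mem_Ioc] at hk
    rw [Int.toNat_of_nonpos (by omega)]; simp
  · rw [Finset.mem_Ioc] at hk
    have : ((k.toNat : ℤ) : ℝ) = k := by rw [Int.toNat_of_nonneg hk.1.le]
    rw [mul_comm, ← this, Int.cast_natCast]

lemma wick_neg_of_wick_pos (hE : IsLoopFunctional N E) {d : ℕ}
    (ih : ∀ (n : ℤ) (s : ℤ →₀ ℕ), 0 < n → n.toNat + posWeight s < d →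
      E (X n * monomial s 1) = n * E (pderiv (-n) (monomial s 1)))
    {l : ℤ} (hl : l < 0) (s : ℤ →₀ ℕ) (hs : posWeight s < d) :
    E (X l * monomial s 1) = -l * E (pderiv (-l) (monomial s 1)) := by
  by_cases hw : Finsupp.weight (id : ℤ → ℤ) s + l = 0
  · have hw' := weight_id_eq s
    have := ih (-l) (s.equivMapDomain (Equiv.neg ℤ)) (by omega) (by rw [posWeight_neg]; omega)
    rw [X_mul_monomial, pderiv_monomial_one] at this ⊢
    have e1 : Finsupp.single (-l) 1 + s.equivMapDomain (Equiv.neg ℤ) =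
        (Finsupp.single l 1 + s).equivMapDomain (Equiv.neg ℤ) := by
      ext k
      have : -l = k ↔ l = -k := by omega
      simp [Finsupp.single_apply, this]
    have e2 : s.equivMapDomain (Equiv.neg ℤ) - Finsupp.single (- -l) 1 =
        (s - Finsupp.single (-l) 1).equivMapDomain (Equiv.neg ℤ) := by
      ext k; simp [Finsupp.single_apply, neg_eq_iff_eq_neg]
    rw [e1, e2, hE.map_neg, map_smul, hE.map_neg] at this
    have := congrArg (starRingEnd ℂ) this
    simpa using this
  · rw [X_mul_monomial, hE.eq_zero, pderiv_monomial_one, map_smul]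
    · by_cases h0 : s (-l) = 0
      · simp [h0]
      · rw [hE.eq_zero]
        · simp
        · have := Finsupp.weight_sub_single_add (w := (id : ℤ → ℤ)) h0
          simp only [id] at this
          omega
    · rw [map_add, Finsupp.weight_single]
      simp only [id, one_smul]
      omega

/-- The Wick identity at positive indices, in the stable range. -/
theorem wick_pos (hE : IsLoopFunctional N E) (d : ℕ) (hd : d ≤ N) :
    ∀ (n : ℤ) (s : ℤ →₀ ℕ), 0 < n → n.toNat + posWeight s = d →
      E (X n * monomial s 1) = n * E (pderiv (-n) (monomial s 1)) := by
  induction d using Nat.strong_induction_on with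
  | _ d ih =>
  intro n₀ s₀ hn₀ hs₀
  have hd1 : 1 ≤ d := by omega
  have hN : 1 ≤ N := hd1.trans hd
  have hN' : (0 : ℝ) < N := by exact_mod_cast hN
  have ih' : ∀ (n : ℤ) (s : ℤ →₀ ℕ), 0 < n → n.toNat + posWeight s < d →
      E (X n * monomial s 1) = n * E (pderiv (-n) (monomial s 1)) := fun n s hn h =>
    ih _ h (by omega) n s hn rfl
  have step : ∀ C : ℝ, 0 ≤ C → (∀ (n : ℤ) (s : ℤ →₀ ℕ), 0 < n → n.toNat + posWeight s = d →
        nonposWeight s = nonposWeight s₀ → ‖wickError E n (monomial s 1)‖ ≤ C) →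
      ∀ (n : ℤ) (s : ℤ →₀ ℕ), 0 < n → n.toNat + posWeight s = d →
        nonposWeight s = nonposWeight s₀ →
        ‖wickError E n (monomial s 1)‖ ≤ ((d - 1 : ℝ) / N) * C := by
    intro C hC hb n s hn hnd hns
    obtain ⟨B, hB⟩ : ∃ B : ℕ, ∀ k ∈ s.support, |k| ≤ B := by
      refine ⟨∑ k ∈ s.support, k.natAbs, fun k hk => ?_⟩
      rw [Int.abs_eq_natAbs]
      exact_mod_cast Finset.single_le_sum (f := fun k : ℤ => k.natAbs) (fun _ _ => Nat.zero_le _) hk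
    have hloop := hE.loop_wickError hn s (fun l hl k => by
      rw [pderiv_monomial_one]
      by_cases h0 : s k = 0
      · simp [h0]
      · rw [mul_smul_comm, map_smul, (pderiv (-l)).map_smul, map_smul, hE.wick_neg_of_wick_pos ih' hl]
        · simp only [smul_eq_mul]; ring
        · have := weight_sub_single (w := fun k : ℤ => k.toNat) h0
          simp only [posWeight] at hnd ⊢
          omega) B hB
    have h1 : ‖∑ j ∈ Finset.Ioo 0 n, wickError E j (X (n - j) * monomial s 1)‖ ≤
        ((n : ℝ) - 1) * C := by
      refine (norm_sum_le_of_le _ (f := fun j => wickError E j (X (n - j) * monomial s 1))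
        (n := fun _ => C) ?_).trans_eq ?_
      · intro j hj
        rw [Finset.mem_Ioo] at hj
        rw [X_mul_monomial]
        refine hb j _ hj.1 ?_ ?_
        · rw [map_add, posWeight, Finsupp.weight_single]
          simp only [posWeight, smul_eq_mul] at hnd ⊢
          omega
        · rw [map_add, nonposWeight, Finsupp.weight_single]
          simp only [nonposWeight, smul_eq_mul] at hns ⊢
          omega
      · rw [Finset.sum_const, Int.card_Ioo, nsmul_eq_mul]
        congr 1
        rw [← Int.cast_natCast (R := ℝ), Int.toNat_of_nonneg (by omega)]; push_cast; ring
    have h2 : ‖∑ k ∈ Finset.Ioc (0 : ℤ) B, (k : ℂ) *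
        wickError E (n + k) (pderiv k (monomial s 1))‖ ≤ posWeight s * C := by
      rw [posWeight_eq_sum s B hB, Finset.sum_mul]
      refine norm_sum_le_of_le _ fun k hk => ?_
      rw [Finset.mem_Ioc] at hk
      have hk' : ‖(k : ℂ)‖ = k := by
        rw [Complex.norm_intCast, abs_of_pos (by exact_mod_cast hk.1)]
      have hsm : wickError E (n + k) (pderiv k (monomial s 1)) =
          (s k : ℂ) * wickError E (n + k) (monomial (s - Finsupp.single k 1) 1) := by
        simp only [wickError]
        rw [pderiv_monomial_one, mul_smul_comm, map_smul, (pderiv _).map_smul, map_smul]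
        simp only [smul_eq_mul]; ring
      rw [hsm, norm_mul, hk', norm_mul, Complex.norm_natCast, mul_assoc]
      by_cases h0 : s k = 0
      · simp [h0]
      have hk0 : (0 : ℝ) ≤ k := by exact_mod_cast hk.1.le
      gcongr
      refine hb _ _ (by omega) ?_ ?_
      · have := weight_sub_single (w := fun k : ℤ => k.toNat) h0
        simp only [posWeight] at hnd ⊢
        omega
      · have := weight_sub_single (w := fun k : ℤ => (1 - k).toNat) h0
        simp only [nonposWeight] at hns ⊢
        omega
    have h3 : (N : ℂ) * wickError E n (monomial s 1) =
        -(∑ j ∈ Finset.Ioo 0 n, wickError E j (X (n - j) * monomial s 1) +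
        ∑ k ∈ Finset.Ioc (0 : ℤ) B, (k : ℂ) *
          wickError E (n + k) (pderiv k (monomial s 1))) := by
      linear_combination hloop
    have h4 : (N : ℝ) * ‖wickError E n (monomial s 1)‖ ≤ (d - 1) * C := by
      rw [← Complex.norm_natCast, ← norm_mul, h3, norm_neg]
      refine (norm_add_le _ _).trans ((add_le_add h1 h2).trans_eq ?_)
      have : (d : ℝ) = n + posWeight s := by
        rw [← hnd]; push_cast
        congr 1
        rw [← Int.cast_natCast (R := ℝ), Int.toNat_of_nonneg (by omega)]
      rw [this]; ring
    rw [div_mul_eq_mul_div, le_div_iff₀ hN']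
    linarith
  have hiter : ∃ C : ℝ, ∀ t : ℕ,
      ‖wickError E n₀ (monomial s₀ 1)‖ ≤ ((d - 1 : ℝ) / N) ^ t * C := by
    have hr0 : 0 ≤ (d - 1 : ℝ) / N :=
      div_nonneg (sub_nonneg.2 (by exact_mod_cast hd1)) hN'.le
    let C : ℝ := (1 + d * (d + nonposWeight s₀)) * (N : ℝ) ^ (1 + d + nonposWeight s₀)
    have hC : 0 ≤ C := by positivity
    have key : ∀ t : ℕ, ∀ (n : ℤ) (s : ℤ →₀ ℕ), 0 < n → n.toNat + posWeight s = d →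
        nonposWeight s = nonposWeight s₀ →
        ‖wickError E n (monomial s 1)‖ ≤ ((d - 1 : ℝ) / N) ^ t * C := by
      intro t
      induction t with
      | zero =>
        intro n s hn hnd hns
        refine (hE.norm_wickError_le hN hn s).trans ?_
        rw [pow_zero, one_mul, hns]
        have e : ((n.toNat : ℝ) + posWeight s) = d := by exact_mod_cast hnd
        have e' : (posWeight s : ℝ) ≤ d := by
          rw [← hnd]; push_cast; exact le_add_of_nonneg_left (by positivity)
        have e'' : posWeight s ≤ d := by omega
        have hN1 : (1 : ℝ) ≤ N := by exact_mod_cast hN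
        rw [e]
        simp only [C]
        gcongr
      | succ t iht =>
        intro n s hn hnd hns
        refine (step _ (by positivity) iht n s hn hnd hns).trans_eq ?_
        rw [pow_succ]; ring
    exact ⟨C, fun t => key t n₀ s₀ hn₀ hs₀ rfl⟩
  obtain ⟨C, hC⟩ := hiter
  have hlim : Tendsto (fun t : ℕ => ((d - 1 : ℝ) / N) ^ t * C) atTop (nhds (0 * C)) := by
    refine (tendsto_pow_atTop_nhds_zero_of_lt_one ?_ ?_).mul_const C
    · exact div_nonneg (sub_nonneg.2 (by exact_mod_cast hd1)) hN'.le
    · rw [div_lt_one hN']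
      have : (d : ℝ) ≤ N := by exact_mod_cast hd
      linarith
  rw [zero_mul] at hlim
  have h0 : ‖wickError E n₀ (monomial s₀ 1)‖ ≤ 0 := ge_of_tendsto' hlim hC
  have := norm_le_zero_iff.1 h0
  rwa [wickError, sub_eq_zero] at this

/-- The Wick identity for monomials of total size at most `2 N`. -/
theorem wick (hE : IsLoopFunctional N E) (n : ℤ) (hn : n ≠ 0) (s : ℤ →₀ ℕ)
    (hs : n.natAbs + Finsupp.weight Int.natAbs s ≤ 2 * N) :
    E (X n * monomial s 1) = (n.natAbs : ℂ) * E (pderiv (-n) (monomial s 1)) := by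
  by_cases hw : Finsupp.weight (id : ℤ → ℤ) s + n = 0
  · have hw' := weight_id_eq s
    have habs : Finsupp.weight Int.natAbs s = posWeight s + negWeight s := by
      simp only [posWeight, negWeight, Finsupp.weight_apply, Finsupp.sum]
      rw [← Finset.sum_add_distrib]
      refine Finset.sum_congr rfl fun k _ => ?_
      simp only [smul_eq_mul]
      rw [← mul_add]
      congr 1; omega
    rcases lt_or_gt_of_ne hn with h | h
    · rw [hE.wick_neg_of_wick_pos (d := N + 1) (fun n s hn h => hE.wick_pos _ (by omega) n s hn rfl)
        h s (by omega)]
      congr 1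
      rw [← Int.cast_natCast, Int.ofNat_natAbs_of_nonpos h.le]; push_cast; rfl
    · rw [hE.wick_pos _ (by omega) n s h rfl]
      congr 1
      rw [← Int.cast_natCast, Int.natAbs_of_nonneg h.le]
  · rw [X_mul_monomial, hE.eq_zero, pderiv_monomial_one, map_smul]
    · by_cases h0 : s (-n) = 0
      · simp [h0]
      · rw [hE.eq_zero]
        · simp
        · have := Finsupp.weight_sub_single_add (w := (id : ℤ → ℤ)) h0
          simp only [id] at this
          omega
    · rw [map_add, Finsupp.weight_single]
      simp only [id, one_smul]
      omega

end IsLoopFunctional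

namespace HaarTrace

open MvPolynomial Matrix

variable {N : ℕ}

instance : BorelSpace (Matrix.unitaryGroup (Fin N) ℂ) := ⟨rfl⟩

instance : CompactSpace (Matrix.unitaryGroup (Fin N) ℂ) := by
  have hpi : IsCompact (Set.univ.pi fun _ : Fin N => Set.univ.pi fun _ : Fin N =>
      Metric.closedBall (0 : ℂ) 1) :=
    isCompact_univ_pi fun _ => isCompact_univ_pi fun _ => isCompact_closedBall _ _
  have hcl : IsClosed ((Matrix.unitaryGroup (Fin N) ℂ : Submonoid _) :
      Set (Matrix (Fin N) (Fin N) ℂ)) := isClosed_unitary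
  refine isCompact_iff_compactSpace.1 (IsCompact.of_isClosed_subset
    (X := Matrix (Fin N) (Fin N) ℂ) hpi hcl fun U hU i _ j _ => ?_)
  rw [mem_closedBall_zero_iff]
  exact entry_norm_bound_of_unitary hU i j

/-- The trace of the `n`-th power of a unitary matrix. -/
noncomputable def powTrace (U : Matrix.unitaryGroup (Fin N) ℂ) (n : ℤ) : ℂ :=
  Matrix.trace ((U ^ n : Matrix.unitaryGroup (Fin N) ℂ) : Matrix (Fin N) (Fin N) ℂ)

lemma continuous_coe_zpow (n : ℤ) : Continuous fun U : Matrix.unitaryGroup (Fin N) ℂ =>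
    ((U ^ n : Matrix.unitaryGroup (Fin N) ℂ) : Matrix (Fin N) (Fin N) ℂ) :=
  continuous_subtype_val.comp (continuous_zpow n)

lemma continuous_coe_pow (n : ℕ) : Continuous fun U : Matrix.unitaryGroup (Fin N) ℂ =>
    (U : Matrix (Fin N) (Fin N) ℂ) ^ n :=
  continuous_subtype_val.pow n

lemma continuous_powTrace (n : ℤ) :
    Continuous fun U : Matrix.unitaryGroup (Fin N) ℂ => powTrace U n :=
  (continuous_coe_zpow n).matrix_trace

lemma continuous_aeval (P : MvPolynomial ℤ ℂ) :
    Continuous fun U : Matrix.unitaryGroup (Fin N) ℂ => aeval (powTrace U) P := by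
  induction P using MvPolynomial.induction_on with
  | C a => simpa using continuous_const
  | add p q hp hq => simp only [map_add]; exact hp.add hq
  | mul_X p n hp => simp only [map_mul, aeval_X]; exact hp.mul (continuous_powTrace n)

lemma integrable_of_continuous (μ : Measure (Matrix.unitaryGroup (Fin N) ℂ))
    [IsProbabilityMeasure μ] {F : Matrix.unitaryGroup (Fin N) ℂ → ℂ} (hF : Continuous F) :
    Integrable F μ :=
  hF.integrable_of_hasCompactSupport (HasCompactSupport.of_compactSpace F)

/-- The expectation of a polynomial in the traces of powers. -/
noncomputable def expectation (μ : Measure (Matrix.unitaryGroup (Fin N) ℂ))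
    [IsProbabilityMeasure μ] : MvPolynomial ℤ ℂ →ₗ[ℂ] ℂ where
  toFun P := ∫ U, aeval (powTrace U) P ∂μ
  map_add' P Q := by
    simp only [map_add]
    exact integral_add (integrable_of_continuous μ (continuous_aeval P))
      (integrable_of_continuous μ (continuous_aeval Q))
  map_smul' c P := by
    simp only [map_smul, RingHom.id_apply, smul_eq_mul]
    exact integral_const_mul _ _

lemma expectation_apply (μ : Measure (Matrix.unitaryGroup (Fin N) ℂ))
    [IsProbabilityMeasure μ] (P : MvPolynomial ℤ ℂ) :
    expectation μ P = ∫ U, aeval (powTrace U) P ∂μ := rfl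

lemma powTrace_zero (U : Matrix.unitaryGroup (Fin N) ℂ) : powTrace U 0 = N := by
  simp [powTrace]

lemma powTrace_natCast (U : Matrix.unitaryGroup (Fin N) ℂ) (n : ℕ) :
    powTrace U n = Matrix.trace ((U : Matrix (Fin N) (Fin N) ℂ) ^ n) := by
  simp [powTrace]

lemma powTrace_neg (U : Matrix.unitaryGroup (Fin N) ℂ) (n : ℤ) :
    powTrace U (-n) = starRingEnd ℂ (powTrace U n) := by
  rw [powTrace, _root_.zpow_neg, powTrace, starRingEnd_apply, ← Matrix.trace_conjTranspose]
  rfl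

lemma norm_powTrace_le (U : Matrix.unitaryGroup (Fin N) ℂ) (n : ℤ) : ‖powTrace U n‖ ≤ N := by
  refine (norm_sum_le_of_le _ (n := fun _ => (1 : ℝ))
    fun i _ => entry_norm_bound_of_unitary (U ^ n).2 i i).trans_eq ?_
  simp

lemma aeval_monomial_one (U : Matrix.unitaryGroup (Fin N) ℂ) (s : ℤ →₀ ℕ) :
    aeval (powTrace U) (monomial s (1 : ℂ)) = s.prod fun k c => powTrace U k ^ c := by
  simp [aeval_monomial]

lemma norm_aeval_monomial_le (U : Matrix.unitaryGroup (Fin N) ℂ) (s : ℤ →₀ ℕ) :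
    ‖aeval (powTrace U) (monomial s (1 : ℂ))‖ ≤ (N : ℝ) ^ s.degree := by
  rw [aeval_monomial_one, Finsupp.prod, norm_prod, Finsupp.degree_apply, ← Finset.prod_pow_eq_pow_sum]
  refine Finset.prod_le_prod (fun _ _ => norm_nonneg _) fun k _ => ?_
  rw [norm_pow]
  exact pow_le_pow_left₀ (norm_nonneg _) (norm_powTrace_le U k) _

lemma aeval_monomial_neg (U : Matrix.unitaryGroup (Fin N) ℂ) (s : ℤ →₀ ℕ) :
    aeval (powTrace U) (monomial (s.equivMapDomain (Equiv.neg ℤ)) (1 : ℂ)) =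
      starRingEnd ℂ (aeval (powTrace U) (monomial s (1 : ℂ))) := by
  rw [aeval_monomial_one, aeval_monomial_one, Finsupp.prod_equivMapDomain, Finsupp.prod,
    Finsupp.prod, map_prod]
  simp [powTrace_neg]

/-- The scalar unitary matrix `exp (iθ)`. -/
noncomputable def scalarUnitary (N : ℕ) (θ : ℝ) : Matrix.unitaryGroup (Fin N) ℂ :=
  ⟨Complex.exp (θ * Complex.I) • (1 : Matrix (Fin N) (Fin N) ℂ), by
    rw [Matrix.mem_unitaryGroup_iff, star_smul, star_one, smul_mul_smul_comm, mul_one,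
      ← starRingEnd_apply, Complex.mul_conj, Complex.normSq_eq_norm_sq,
      Complex.norm_exp_ofReal_mul_I]
    simp⟩

lemma scalarUnitary_add (a b : ℝ) :
    scalarUnitary N (a + b) = scalarUnitary N a * scalarUnitary N b := by
  ext1
  simp [scalarUnitary, add_mul, Complex.exp_add, smul_smul]
  exact Or.inl (mul_comm _ _)

lemma scalarUnitary_zero : scalarUnitary N 0 = 1 := by
  ext1
  simp [scalarUnitary]

lemma scalarUnitary_zpow (θ : ℝ) (n : ℤ) : scalarUnitary N θ ^ n = scalarUnitary N (n * θ) := by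
  let φ : Multiplicative ℝ →* Matrix.unitaryGroup (Fin N) ℂ :=
    { toFun := fun x => scalarUnitary N x.toAdd
      map_one' := scalarUnitary_zero
      map_mul' := fun a b => scalarUnitary_add _ _ }
  have := map_zpow φ (Multiplicative.ofAdd θ) n
  simpa [φ] using this.symm

lemma powTrace_scalarUnitary_mul (θ : ℝ) (U : Matrix.unitaryGroup (Fin N) ℂ) (n : ℤ) :
    powTrace (scalarUnitary N θ * U) n = Complex.exp (n * θ * Complex.I) * powTrace U n := by
  have hc : Commute (scalarUnitary N θ) U := by
    ext1
    simp [scalarUnitary]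
  rw [powTrace, hc.mul_zpow, scalarUnitary_zpow]
  simp [scalarUnitary, powTrace]

lemma aeval_scalarUnitary_mul (θ : ℝ) (U : Matrix.unitaryGroup (Fin N) ℂ) (s : ℤ →₀ ℕ) :
    aeval (powTrace (scalarUnitary N θ * U)) (monomial s (1 : ℂ)) =
      Complex.exp ((Finsupp.weight (id : ℤ → ℤ) s : ℤ) * θ * Complex.I) *
        aeval (powTrace U) (monomial s (1 : ℂ)) := by
  rw [aeval_monomial_one, aeval_monomial_one, Finsupp.prod, Finsupp.prod,
    Finsupp.weight_apply, Finsupp.sum]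
  push_cast
  rw [Finset.sum_mul, Finset.sum_mul, Complex.exp_sum, ← Finset.prod_mul_distrib]
  refine Finset.prod_congr rfl fun k _ => ?_
  rw [powTrace_scalarUnitary_mul, mul_pow, ← Complex.exp_nat_mul]
  congr 2
  simp only [id, nsmul_eq_mul]
  push_cast
  ring

lemma expectation_eq_zero (μ : Measure (Matrix.unitaryGroup (Fin N) ℂ))
    [IsProbabilityMeasure μ] [μ.IsMulLeftInvariant] (s : ℤ →₀ ℕ)
    (hs : Finsupp.weight (id : ℤ → ℤ) s ≠ 0) : expectation μ (monomial s 1) = 0 := by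
  set w : ℤ := Finsupp.weight (id : ℤ → ℤ) s with hw
  have hw0 : (w : ℂ) ≠ 0 := by exact_mod_cast hs
  have h1 := integral_mul_left_eq_self (μ := μ)
    (fun U => aeval (powTrace U) (monomial s (1 : ℂ))) (scalarUnitary N (Real.pi / w))
  simp only [aeval_scalarUnitary_mul] at h1
  have h2 : Complex.exp ((w : ℂ) * ((Real.pi / w : ℝ) : ℂ) * Complex.I) = -1 := by
    push_cast
    rw [mul_div_cancel₀ _ hw0, Complex.exp_pi_mul_I]
  rw [← hw, h2, integral_const_mul] at h1
  rw [expectation_apply]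
  have h3 : (2 : ℂ) * ∫ U, aeval (powTrace U) (monomial s (1 : ℂ)) ∂μ = 0 := by
    linear_combination -h1
  simpa using h3

lemma hasDerivAt_aeval {x : ℝ → ℤ → ℂ} {x' : ℤ → ℂ} {t : ℝ}
    (hx : ∀ k, HasDerivAt (fun u => x u k) (x' k) t) (T : Finset ℤ) {P : MvPolynomial ℤ ℂ}
    (hP : P ∈ MvPolynomial.supported ℂ (T : Set ℤ)) :
    HasDerivAt (fun u => aeval (x u) P) (∑ k ∈ T, aeval (x t) (pderiv k P) * x' k) t := by
  induction hP using Algebra.adjoin_induction with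
  | mem y hy =>
    obtain ⟨j, hj, rfl⟩ := hy
    have : ∑ k ∈ T, aeval (x t) (pderiv k (X j : MvPolynomial ℤ ℂ)) * x' k = x' j := by
      rw [Finset.sum_eq_single j]
      · simp
      · intro k _ hk
        rw [pderiv_X_of_ne hk.symm]; simp
      · intro h; exact absurd hj h
    rw [this]
    simpa using hx j
  | algebraMap r =>
    simpa [MvPolynomial.algebraMap_eq] using hasDerivAt_const t r
  | add p q _ _ hp hq =>
    have := hp.add hq
    simp only [map_add, add_mul, Finset.sum_add_distrib]
    exact this
  | mul p q _ _ hp hq =>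
    have := hp.mul hq
    simp only [map_mul]
    refine this.congr_deriv ?_
    symm
    rw [Finset.sum_mul, Finset.mul_sum, ← Finset.sum_add_distrib]
    refine Finset.sum_congr rfl fun k _ => ?_
    rw [pderiv_mul]
    simp only [map_add, map_mul]
    ring

section Flow

open scoped Matrix.Norms.L2Operator

/-- The one-parameter subgroup generated by a skew-adjoint matrix. -/
noncomputable def flow (A : skewAdjoint (Matrix (Fin N) (Fin N) ℂ)) (t : ℝ) :
    Matrix.unitaryGroup (Fin N) ℂ :=
  ⟨NormedSpace.exp (t • (A : Matrix (Fin N) (Fin N) ℂ)), by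
    let +nondep : NormedAlgebra ℚ (Matrix (Fin N) (Fin N) ℂ) := .restrictScalars ℚ ℂ _
    exact NormedSpace.exp_mem_unitary_of_mem_skewAdjoint (skewAdjoint.smul_mem t A.2)⟩

lemma flow_zero (A : skewAdjoint (Matrix (Fin N) (Fin N) ℂ)) : flow A 0 = 1 := by
  ext1
  simp [flow]

lemma hasDerivAt_flow_mul_pow (A : skewAdjoint (Matrix (Fin N) (Fin N) ℂ))
    (U : Matrix.unitaryGroup (Fin N) ℂ) (n : ℕ) (t : ℝ) :
    HasDerivAt (fun u : ℝ => ((flow A u * U : Matrix.unitaryGroup (Fin N) ℂ) :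
        Matrix (Fin N) (Fin N) ℂ) ^ n)
      (∑ j ∈ Finset.range n,
        ((flow A t * U : Matrix.unitaryGroup (Fin N) ℂ) : Matrix (Fin N) (Fin N) ℂ) ^ j *
        (A : Matrix (Fin N) (Fin N) ℂ) *
        ((flow A t * U : Matrix.unitaryGroup (Fin N) ℂ) : Matrix (Fin N) (Fin N) ℂ) ^ (n - j)) t := by
  have h1 : HasDerivAt (fun u : ℝ => ((flow A u * U : Matrix.unitaryGroup (Fin N) ℂ) :
        Matrix (Fin N) (Fin N) ℂ))
      ((A : Matrix (Fin N) (Fin N) ℂ) *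
        ((flow A t * U : Matrix.unitaryGroup (Fin N) ℂ) : Matrix (Fin N) (Fin N) ℂ)) t := by
    have := (hasDerivAt_exp_smul_const' (𝕂 := ℝ) (A : Matrix (Fin N) (Fin N) ℂ) t).mul_const
      (U : Matrix (Fin N) (Fin N) ℂ)
    simpa [flow, mul_assoc] using this
  induction n with
  | zero => simpa using hasDerivAt_const t (1 : Matrix (Fin N) (Fin N) ℂ)
  | succ n ih =>
    have := ih.mul h1
    simp only [pow_succ _ n]
    refine this.congr_deriv ?_
    symm
    rw [Finset.sum_range_succ, Finset.sum_mul]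
    congr 1
    · refine Finset.sum_congr rfl fun j hj => ?_
      rw [Finset.mem_range] at hj
      rw [show n + 1 - j = (n - j) + 1 by omega, pow_succ]
      simp only [mul_assoc]
    · simp [mul_assoc]

/-- The trace of a product with a fixed matrix, as a continuous real-linear map. -/
noncomputable def traceMulCLM (Y : Matrix (Fin N) (Fin N) ℂ) :
    Matrix (Fin N) (Fin N) ℂ →L[ℝ] ℂ :=
  LinearMap.toContinuousLinearMap
    { toFun := fun Z => Matrix.trace (Y * Z)
      map_add' := by intros; simp [mul_add]
      map_smul' := by intros; simp }

lemma hasDerivAt_trace_mul_flow_pow (A : skewAdjoint (Matrix (Fin N) (Fin N) ℂ))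
    (Y : Matrix (Fin N) (Fin N) ℂ) (U : Matrix.unitaryGroup (Fin N) ℂ) (n : ℕ) (t : ℝ) :
    HasDerivAt (fun u : ℝ => Matrix.trace (Y *
        ((flow A u * U : Matrix.unitaryGroup (Fin N) ℂ) : Matrix (Fin N) (Fin N) ℂ) ^ n))
      (∑ j ∈ Finset.range n, Matrix.trace (Y *
        (((flow A t * U : Matrix.unitaryGroup (Fin N) ℂ) : Matrix (Fin N) (Fin N) ℂ) ^ j *
        (A : Matrix (Fin N) (Fin N) ℂ) *
        ((flow A t * U : Matrix.unitaryGroup (Fin N) ℂ) : Matrix (Fin N) (Fin N) ℂ) ^ (n - j)))) t := by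
  have := (traceMulCLM Y).hasFDerivAt.comp_hasDerivAt t (hasDerivAt_flow_mul_pow A U n t)
  refine this.congr_deriv ?_
  symm
  rw [map_sum]
  rfl

lemma hasDerivAt_powTrace (A : skewAdjoint (Matrix (Fin N) (Fin N) ℂ))
    (U : Matrix.unitaryGroup (Fin N) ℂ) (k : ℤ) (t : ℝ) :
    HasDerivAt (fun u : ℝ => powTrace (flow A u * U) k)
      (k * Matrix.trace ((A : Matrix (Fin N) (Fin N) ℂ) *
        (((flow A t * U) ^ k : Matrix.unitaryGroup (Fin N) ℂ) : Matrix (Fin N) (Fin N) ℂ))) t := by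
  have hnat : ∀ n : ℕ, HasDerivAt (fun u : ℝ => powTrace (flow A u * U) n)
      (n * Matrix.trace ((A : Matrix (Fin N) (Fin N) ℂ) *
        ((flow A t * U : Matrix.unitaryGroup (Fin N) ℂ) : Matrix (Fin N) (Fin N) ℂ) ^ n)) t := by
    intro n
    have := hasDerivAt_trace_mul_flow_pow A 1 U n t
    simp only [powTrace_natCast]
    simp only [one_mul] at this
    refine this.congr_deriv ?_
    symm
    rw [Finset.sum_congr rfl (g := fun _ => Matrix.trace ((A : Matrix (Fin N) (Fin N) ℂ) *
      ((flow A t * U : Matrix.unitaryGroup (Fin N) ℂ) : Matrix (Fin N) (Fin N) ℂ) ^ n))]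
    · simp
    · intro j hj
      rw [Finset.mem_range] at hj
      rw [mul_assoc, Matrix.trace_mul_comm, mul_assoc, ← pow_add,
        show n - j + j = n by omega]
  obtain ⟨n, rfl | rfl⟩ := k.eq_nat_or_neg
  · simpa using hnat n
  · have := (hnat n).star
    simp only [powTrace_neg, starRingEnd_apply]
    refine this.congr_deriv ?_
    symm
    rw [star_mul', ← Matrix.trace_conjTranspose, Matrix.conjTranspose_mul,
      Matrix.trace_mul_comm, ← Matrix.star_eq_conjTranspose, ← Matrix.star_eq_conjTranspose,
      skewAdjoint.mem_iff.1 A.2, _root_.zpow_neg, _root_.zpow_natCast]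
    have : (((flow A t * U) ^ n)⁻¹ : Matrix.unitaryGroup (Fin N) ℂ).1 =
      star (((flow A t * U : Matrix.unitaryGroup (Fin N) ℂ) : Matrix (Fin N) (Fin N) ℂ) ^ n) := rfl
    rw [this]
    simp

end Flow

/-- The derivative of `U ↦ Tr (Y U ^ n) P(U)` in the direction `A U`. -/
noncomputable def dirDeriv (Y : Matrix (Fin N) (Fin N) ℂ) (n : ℕ) (P : MvPolynomial ℤ ℂ)
    (T : Finset ℤ) (A : Matrix (Fin N) (Fin N) ℂ) (U : Matrix.unitaryGroup (Fin N) ℂ) : ℂ :=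
  (∑ j ∈ Finset.range n, Matrix.trace (Y * ((U : Matrix (Fin N) (Fin N) ℂ) ^ j * A *
      (U : Matrix (Fin N) (Fin N) ℂ) ^ (n - j)))) * aeval (powTrace U) P +
    Matrix.trace (Y * (U : Matrix (Fin N) (Fin N) ℂ) ^ n) *
      ∑ k ∈ T, aeval (powTrace U) (pderiv k P) * (k * Matrix.trace (A *
        ((U ^ k : Matrix.unitaryGroup (Fin N) ℂ) : Matrix (Fin N) (Fin N) ℂ)))

lemma continuous_dirDeriv (Y : Matrix (Fin N) (Fin N) ℂ) (n : ℕ) (P : MvPolynomial ℤ ℂ)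
    (T : Finset ℤ) (A : Matrix (Fin N) (Fin N) ℂ) : Continuous (dirDeriv Y n P T A) := by
  unfold dirDeriv
  refine ((continuous_finsetSum _ fun j _ => ?_).mul (continuous_aeval P)).add
    (Continuous.mul ?_ (continuous_finsetSum _ fun k _ => ?_))
  · exact (continuous_const.mul (((continuous_coe_pow j).mul continuous_const).mul
      (continuous_coe_pow (n - j)))).matrix_trace
  · exact (continuous_const.mul (continuous_coe_pow n)).matrix_trace
  · exact (continuous_aeval _).mul (continuous_const.mul
      (continuous_const.mul (continuous_coe_zpow k)).matrix_trace)

lemma dirDeriv_add_smul (Y : Matrix (Fin N) (Fin N) ℂ) (n : ℕ) (P : MvPolynomial ℤ ℂ)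
    (T : Finset ℤ) (A B : Matrix (Fin N) (Fin N) ℂ) (c : ℂ) (U : Matrix.unitaryGroup (Fin N) ℂ) :
    dirDeriv Y n P T (A + c • B) U = dirDeriv Y n P T A U + c * dirDeriv Y n P T B U := by
  simp only [dirDeriv, mul_add, add_mul, Matrix.trace_add, Finset.sum_add_distrib, mul_smul_comm,
    smul_mul_assoc, Matrix.trace_smul, smul_eq_mul]
  simp only [Finset.mul_sum, Finset.sum_mul]
  rw [add_add_add_comm]
  congr 2 <;> refine Finset.sum_congr rfl fun _ _ => ?_ <;> ring

lemma hasDerivAt_dirDeriv (A : skewAdjoint (Matrix (Fin N) (Fin N) ℂ))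
    (Y : Matrix (Fin N) (Fin N) ℂ) (n : ℕ) {P : MvPolynomial ℤ ℂ} {T : Finset ℤ}
    (hP : P ∈ MvPolynomial.supported ℂ (T : Set ℤ)) (U : Matrix.unitaryGroup (Fin N) ℂ) (t : ℝ) :
    HasDerivAt (fun u : ℝ => Matrix.trace (Y *
        ((flow A u * U : Matrix.unitaryGroup (Fin N) ℂ) : Matrix (Fin N) (Fin N) ℂ) ^ n) *
        aeval (powTrace (flow A u * U)) P)
      (dirDeriv Y n P T A (flow A t * U)) t :=
  (hasDerivAt_trace_mul_flow_pow A Y U n t).mul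
    (hasDerivAt_aeval (fun k => hasDerivAt_powTrace A U k t) T hP)

lemma integral_dirDeriv_skewAdjoint (μ : Measure (Matrix.unitaryGroup (Fin N) ℂ))
    [IsProbabilityMeasure μ] [μ.IsMulLeftInvariant]
    (A : skewAdjoint (Matrix (Fin N) (Fin N) ℂ))
    (Y : Matrix (Fin N) (Fin N) ℂ) (n : ℕ) {P : MvPolynomial ℤ ℂ} {T : Finset ℤ}
    (hP : P ∈ MvPolynomial.supported ℂ (T : Set ℤ)) :
    ∫ U, dirDeriv Y n P T A U ∂μ = 0 := by
  let G : Matrix.unitaryGroup (Fin N) ℂ → ℂ := fun U =>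
    Matrix.trace (Y * (U : Matrix (Fin N) (Fin N) ℂ) ^ n) * aeval (powTrace U) P
  have hG : Continuous G :=
    (continuous_const.mul (continuous_coe_pow n)).matrix_trace.mul (continuous_aeval P)
  have hD := continuous_dirDeriv Y n P T (A : Matrix (Fin N) (Fin N) ℂ)
  obtain ⟨C, hC⟩ := isCompact_univ.exists_bound_of_continuousOn hD.continuousOn
  have key := (hasDerivAt_integral_of_dominated_loc_of_deriv_le (μ := μ) (𝕜 := ℝ)
    (F := fun t U => G (flow A t * U)) (F' := fun t U => dirDeriv Y n P T A (flow A t * U))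
    (x₀ := 0) (s := Set.univ) (bound := fun _ => C) univ_mem
    (Eventually.of_forall fun t =>
      (hG.comp (continuous_const.mul continuous_id)).aestronglyMeasurable)
    (integrable_of_continuous μ (hG.comp (continuous_const.mul continuous_id)))
    (hD.comp (continuous_const.mul continuous_id)).aestronglyMeasurable
    (Eventually.of_forall fun U t _ => hC _ (Set.mem_univ _))
    (integrable_const C)
    (Eventually.of_forall fun U t _ => hasDerivAt_dirDeriv A Y n hP U t)).2
  simp only [integral_mul_left_eq_self (μ := μ) G, flow_zero, one_mul] at key
  exact key.unique (hasDerivAt_const _ _)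

lemma integral_dirDeriv (μ : Measure (Matrix.unitaryGroup (Fin N) ℂ))
    [IsProbabilityMeasure μ] [μ.IsMulLeftInvariant]
    (A Y : Matrix (Fin N) (Fin N) ℂ) (n : ℕ) {P : MvPolynomial ℤ ℂ} {T : Finset ℤ}
    (hP : P ∈ MvPolynomial.supported ℂ (T : Set ℤ)) :
    ∫ U, dirDeriv Y n P T A U ∂μ = 0 := by
  let B : skewAdjoint (Matrix (Fin N) (Fin N) ℂ) := ⟨(1 / 2 : ℂ) • (A - star A), by
    rw [skewAdjoint.mem_iff, star_smul, star_sub, star_star, ← smul_neg, neg_sub]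
    simp⟩
  let D : skewAdjoint (Matrix (Fin N) (Fin N) ℂ) := ⟨(-Complex.I / 2) • (A + star A), by
    rw [skewAdjoint.mem_iff, star_smul, star_add, star_star, ← neg_smul, add_comm (star A)]
    congr 1
    simp [neg_div]⟩
  have hA : A = (B : Matrix (Fin N) (Fin N) ℂ) + Complex.I • (D : Matrix (Fin N) (Fin N) ℂ) := by
    simp only [B, D, smul_smul]
    rw [show Complex.I * (-Complex.I / 2) = 1 / 2 by
      linear_combination (-1 / 2 : ℂ) * Complex.I_mul_I, ← smul_add, sub_add_add_cancel,
      ← two_smul ℂ, smul_smul]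
    simp
  rw [hA]
  simp only [dirDeriv_add_smul]
  rw [integral_add (integrable_of_continuous μ (continuous_dirDeriv _ _ _ _ _))
    ((integrable_of_continuous μ (continuous_dirDeriv _ _ _ _ _)).const_mul _),
    integral_const_mul, integral_dirDeriv_skewAdjoint μ B Y n hP,
    integral_dirDeriv_skewAdjoint μ D Y n hP]
  simp

lemma sum_dirDeriv_single (n : ℕ) (P : MvPolynomial ℤ ℂ) (T : Finset ℤ)
    (U : Matrix.unitaryGroup (Fin N) ℂ) :
    ∑ a, ∑ b, dirDeriv (Matrix.single b a 1) n P T (Matrix.single a b 1) U =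
      aeval (powTrace U) (∑ j ∈ Finset.range n, X (j : ℤ) * (X ((n : ℤ) - j) * P) +
        ∑ k ∈ T, (k : ℂ) • (X ((n : ℤ) + k) * pderiv k P)) := by
  have h1 : ∀ (a b : Fin N) (j : ℕ), Matrix.trace (Matrix.single b a (1 : ℂ) *
      ((U : Matrix (Fin N) (Fin N) ℂ) ^ j * Matrix.single a b 1 *
        (U : Matrix (Fin N) (Fin N) ℂ) ^ (n - j))) =
      ((U : Matrix (Fin N) (Fin N) ℂ) ^ j) a a * ((U : Matrix (Fin N) (Fin N) ℂ) ^ (n - j)) b b := by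
    intro a b j
    rw [← mul_assoc, ← mul_assoc, Matrix.single_mul_mul_single, Matrix.trace_single_mul]
    simp
  have h3 : ∀ k : ℤ, powTrace U (n + k) = ∑ a, ∑ b, ((U : Matrix (Fin N) (Fin N) ℂ) ^ n) a b *
      ((U ^ k : Matrix.unitaryGroup (Fin N) ℂ) : Matrix (Fin N) (Fin N) ℂ) b a := by
    intro k
    rw [powTrace, _root_.zpow_add, _root_.zpow_natCast]
    simp [Matrix.trace, Matrix.mul_apply]
  simp only [dirDeriv, h1, Matrix.trace_single_mul, one_smul, map_add, map_sum, map_mul, map_smul,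
    aeval_X, Finset.sum_add_distrib, h3]
  congr 1
  · simp only [← Finset.sum_mul]
    simp only [Finset.sum_comm (s := Finset.univ) (t := Finset.range n)]
    rw [Finset.sum_mul]
    refine Finset.sum_congr rfl fun j hj => ?_
    rw [Finset.mem_range] at hj
    rw [← Nat.cast_sub hj.le, powTrace_natCast, powTrace_natCast, Matrix.trace, Matrix.trace,
      ← mul_assoc, Finset.sum_mul_sum]
    rfl
  · simp only [Finset.mul_sum]
    simp only [Finset.sum_comm (s := Finset.univ) (t := T)]
    refine Finset.sum_congr rfl fun k _ => ?_
    simp only [Finset.sum_mul, smul_eq_mul, Finset.mul_sum]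
    refine Finset.sum_congr rfl fun a _ => Finset.sum_congr rfl fun b _ => ?_
    ring

theorem isLoopFunctional_expectation (μ : Measure (Matrix.unitaryGroup (Fin N) ℂ))
    [IsProbabilityMeasure μ] [μ.IsMulLeftInvariant] : IsLoopFunctional N (expectation μ) where
  map_X_zero_mul P := by
    simp only [expectation_apply, map_mul, aeval_X, powTrace_zero]
    exact integral_const_mul _ _
  loop n s T hn hT := by
    obtain ⟨n, rfl⟩ := Int.eq_ofNat_of_zero_le hn.le
    have hP : (monomial s 1 : MvPolynomial ℤ ℂ) ∈ MvPolynomial.supported ℂ (T : Set ℤ) := by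
      rw [mem_supported, vars_monomial one_ne_zero]
      exact_mod_cast hT
    have h : ∫ U, ∑ a, ∑ b, dirDeriv (Matrix.single b a 1) n (monomial s 1) T
        (Matrix.single a b 1) U ∂μ = 0 := by
      rw [integral_finsetSum _ fun a _ => integrable_finsetSum _ fun b _ =>
        integrable_of_continuous μ (continuous_dirDeriv _ _ _ _ _)]
      refine Finset.sum_eq_zero fun a _ => ?_
      rw [integral_finsetSum _ fun b _ =>
        integrable_of_continuous μ (continuous_dirDeriv _ _ _ _ _)]
      exact Finset.sum_eq_zero fun b _ => integral_dirDeriv μ _ _ n hP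
    simp only [sum_dirDeriv_single] at h
    rw [← expectation_apply, map_add, map_sum, map_sum] at h
    rw [← h]
    congr 1
    · have hn' : 0 < n := by exact_mod_cast hn
      obtain ⟨n, rfl⟩ := Nat.exists_eq_succ_of_ne_zero hn'.ne'
      rw [Finset.sum_range_succ', add_comm]
      congr 1
      · symm
        refine Finset.sum_nbij' (fun j : ℕ => (j : ℤ) + 1) (fun j : ℤ => (j - 1).toNat)
          ?_ ?_ ?_ ?_ ?_
        · intro j hj; simp only [Finset.mem_range, Finset.mem_Ioo] at hj ⊢; push_cast; omega
        · intro j hj; simp only [Finset.mem_range, Finset.mem_Ioo] at hj ⊢; push_cast at hj; omega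
        · intro j _; simp
        · intro j hj; simp only [Finset.mem_Ioo] at hj; omega
        · intro j _; push_cast; rfl
      · simp only [Nat.cast_zero, sub_zero, expectation_apply, map_mul, aeval_X, powTrace_zero]
        exact (integral_const_mul _ _).symm
    · simp
  norm_le s := by
    rw [expectation_apply]
    refine (norm_integral_le_of_norm_le_const
      (Eventually.of_forall fun U => norm_aeval_monomial_le U s)).trans_eq ?_
    simp
  eq_zero s hs := expectation_eq_zero μ s hs
  map_neg s := by
    simp only [expectation_apply, aeval_monomial_neg]
    exact integral_conj

end HaarTrace

namespace IsLoopFunctional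

open MvPolynomial

variable {N : ℕ} {E : MvPolynomial ℤ ℂ →ₗ[ℂ] ℂ}

theorem wick_of_weight_le (hE : IsLoopFunctional N E) {n : ℤ} (hn : n ≠ 0) {D : ℕ}
    {P : MvPolynomial ℤ ℂ} (hP : ∀ s ∈ P.support, Finsupp.weight Int.natAbs s ≤ D)
    (hD : n.natAbs + D ≤ 2 * N) :
    E (X n * P) = (n.natAbs : ℂ) * E (pderiv (-n) P) := by
  have h : ∀ s ∈ P.support, E (X n * monomial s (coeff s P)) =
      (n.natAbs : ℂ) * E (pderiv (-n) (monomial s (coeff s P))) := by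
    intro s hs
    have hc : (monomial s (coeff s P) : MvPolynomial ℤ ℂ) = coeff s P • monomial s 1 := by
      rw [smul_monomial, smul_eq_mul, mul_one]
    have := hE.wick n hn s ((Nat.add_le_add_left (hP s hs) _).trans hD)
    rw [hc, mul_smul_comm, map_smul, Derivation.map_smul, map_smul, this, smul_eq_mul, smul_eq_mul]
    ring
  conv_lhs => rw [P.as_sum]
  conv_rhs => rw [P.as_sum]
  rw [Finset.mul_sum, map_sum, map_sum, map_sum, Finset.mul_sum]
  exact Finset.sum_congr rfl h

/-- The linear form with coefficients `a`. -/
noncomputable def linearForm (I : Finset ℤ) (a : ℤ → ℂ) : MvPolynomial ℤ ℂ := ∑ n ∈ I, a n • X n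

lemma weight_le_of_mem_support_linearForm {I : Finset ℤ} {a : ℤ → ℂ} {K : ℕ}
    (hI : ∀ n ∈ I, n.natAbs ≤ K) {s : ℤ →₀ ℕ} (hs : s ∈ (linearForm I a).support) :
    Finsupp.weight Int.natAbs s ≤ K := by
  classical
  obtain ⟨n, hn, hs⟩ := Finset.mem_biUnion.1 (support_sum hs)
  have := support_smul hs
  rw [support_X, Finset.mem_singleton] at this
  subst this
  simpa [Finsupp.weight_single] using hI n hn

lemma weight_le_of_mem_support_linearForm_pow {I : Finset ℤ} {a : ℤ → ℂ} {K : ℕ}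
    (hI : ∀ n ∈ I, n.natAbs ≤ K) (k : ℕ) :
    ∀ s ∈ (linearForm I a ^ k).support, Finsupp.weight Int.natAbs s ≤ k * K := by
  classical
  induction k with
  | zero =>
    intro s hs
    rw [pow_zero, support_one, Finset.mem_singleton] at hs
    simp [hs]
  | succ k ih =>
    intro s hs
    rw [pow_succ] at hs
    obtain ⟨u, hu, v, hv, rfl⟩ := Finset.mem_add.1 (support_mul _ _ hs)
    rw [map_add, add_one_mul]
    exact add_le_add (ih u hu) (weight_le_of_mem_support_linearForm hI hv)

lemma pderiv_linearForm {I : Finset ℤ} {a : ℤ → ℂ} {n : ℤ} (hn : n ∈ I) :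
    pderiv n (linearForm I a) = C (a n) := by
  rw [linearForm, map_sum, Finset.sum_eq_single n]
  · rw [Derivation.map_smul, pderiv_X_self, smul_eq_C_mul, mul_one]
  · intro k _ hk
    rw [Derivation.map_smul, pderiv_X_of_ne hk, smul_zero]
  · intro h; exact absurd hn h

theorem linearForm_pow_add_two (hE : IsLoopFunctional N E) {I : Finset ℤ} {a : ℤ → ℂ} {K : ℕ}
    (hI : ∀ n ∈ I, n.natAbs ≤ K) (h0 : 0 ∉ I) (hneg : ∀ n ∈ I, -n ∈ I) {k : ℕ}
    (hk : (k + 2) * K ≤ 2 * N) :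
    E (linearForm I a ^ (k + 2)) =
      (k + 1) * (∑ n ∈ I, (n.natAbs : ℂ) * (a n * a (-n))) * E (linearForm I a ^ k) := by
  have h : ∀ n ∈ I, E (X n * linearForm I a ^ (k + 1)) =
      (n.natAbs : ℂ) * ((k + 1) * a (-n) * E (linearForm I a ^ k)) := by
    intro n hn
    rw [hE.wick_of_weight_le (D := (k + 1) * K) (fun h => h0 (h ▸ hn))
      (weight_le_of_mem_support_linearForm_pow hI (k + 1))
      (by have := hI n hn; linarith), pderiv_pow, pderiv_linearForm (hneg n hn)]
    rw [show ((k + 1 : ℕ) : MvPolynomial ℤ ℂ) * linearForm I a ^ (k + 1 - 1) * C (a (-n)) =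
      (((k : ℂ) + 1) * a (-n)) • linearForm I a ^ k by
        rw [smul_eq_C_mul, C_mul, C_add, map_natCast, C_1, Nat.add_sub_cancel]
        push_cast
        ring, map_smul, smul_eq_mul]
  rw [show k + 2 = (k + 1) + 1 from rfl, pow_succ']
  conv_lhs => rw [linearForm]
  rw [Finset.sum_mul, map_sum, Finset.mul_sum, Finset.sum_mul]
  refine Finset.sum_congr rfl fun n hn => ?_
  rw [smul_mul_assoc, map_smul]
  rw [← linearForm, h n hn, smul_eq_mul]
  ring

/-- Low moments of a linear form coincide with those of a centered Gaussian. -/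
theorem linearForm_pow (hE : IsLoopFunctional N E) (hE1 : E 1 = 1) {I : Finset ℤ} {a : ℤ → ℂ}
    {K : ℕ} (hI : ∀ n ∈ I, n.natAbs ≤ K) (h0 : 0 ∉ I) (hneg : ∀ n ∈ I, -n ∈ I) (k : ℕ)
    (hk : k * K ≤ 2 * N) :
    E (linearForm I a ^ k) = if Odd k then 0 else
      (k.factorial : ℂ) / (2 ^ (k / 2) * (k / 2).factorial) *
        (∑ n ∈ I, (n.natAbs : ℂ) * (a n * a (-n))) ^ (k / 2) := by
  induction k using Nat.twoStepInduction with
  | zero => simp [hE1]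
  | one =>
    rw [if_pos odd_one, pow_one, linearForm, map_sum]
    refine Finset.sum_eq_zero fun n hn => ?_
    have : E (X n) = 0 := hE.eq_zero (Finsupp.single n 1) (by
      simpa [Finsupp.weight_single] using fun h : n = 0 => h0 (h ▸ hn))
    rw [map_smul, this, smul_zero]
  | more k ih _ =>
    rw [hE.linearForm_pow_add_two hI h0 hneg hk, ih (le_trans (by gcongr; omega) hk)]
    have hodd : Odd (k + 2) ↔ Odd k := by simp [Nat.odd_add]
    simp only [hodd]
    split_ifs with h
    · simp
    · obtain ⟨j, rfl⟩ := (Nat.not_odd_iff_even.1 h).two_dvd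
      rw [show 2 * j + 2 = 2 * (j + 1) by ring, Nat.mul_div_cancel_left _ two_pos,
        Nat.mul_div_cancel_left _ two_pos, show 2 * (j + 1) = (2 * j + 1) + 1 by ring,
        Nat.factorial_succ, Nat.factorial_succ (2 * j), Nat.factorial_succ j]
      have : ((j : ℂ) + 1) ≠ 0 := by exact_mod_cast Nat.succ_ne_zero j
      have : (j.factorial : ℂ) ≠ 0 := by exact_mod_cast Nat.factorial_ne_zero j
      push_cast
      field_simp
      ring

end IsLoopFunctional

lemma tendsto_sum_Ico_integral {g : ℝ → ℝ} (hg : UniformContinuous g) :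
    Tendsto (fun N : ℕ => ∑ n ∈ Finset.Ico (-(N : ℤ)) N, 1 / (N : ℝ) * g ((n : ℝ) / N)) atTop
      (nhds (∫ u in (-1 : ℝ)..1, g u)) := by
  rw [Metric.tendsto_atTop]
  intro ε hε
  obtain ⟨δ, hδ, hgδ⟩ := Metric.uniformContinuous_iff.1 hg (ε / 4) (by positivity)
  obtain ⟨M, hM⟩ := exists_nat_gt (1 / δ)
  refine ⟨M + 1, fun N hN => ?_⟩
  have hN0 : (0 : ℝ) < N := by exact_mod_cast (show 0 < N by omega)
  have hNδ : 1 / (N : ℝ) < δ := by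
    rw [div_lt_comm₀ hN0 hδ]
    exact hM.trans_le (by exact_mod_cast (show M ≤ N by omega))
  let x : ℕ → ℝ := fun i => ((i : ℝ) - N) / N
  have hx : ∀ i, x (i + 1) - x i = 1 / N := fun i => by
    simp only [x]
    push_cast
    ring
  have hsum : ∑ n ∈ Finset.Ico (-(N : ℤ)) N, 1 / (N : ℝ) * g ((n : ℝ) / N) =
      ∑ i ∈ Finset.range (2 * N), 1 / (N : ℝ) * g (x i) := by
    refine Finset.sum_nbij' (fun n => (n + N).toNat) (fun i => (i : ℤ) - N) ?_ ?_ ?_ ?_ ?_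
    · intro n hn; simp only [Finset.mem_range, Finset.mem_Ico] at hn ⊢; omega
    · intro i hi; simp only [Finset.mem_range, Finset.mem_Ico] at hi ⊢; omega
    · intro n hn; simp only [Finset.mem_Ico] at hn; omega
    · intro i _; simp
    · intro n hn
      simp only [Finset.mem_Ico] at hn
      have : (((n + N).toNat : ℕ) : ℝ) = n + N := by
        exact_mod_cast congrArg (Int.cast (R := ℝ)) (Int.toNat_of_nonneg (show 0 ≤ n + N by omega))
      simp [x, this]
  have hint : ∫ u in (-1 : ℝ)..1, g u = ∑ i ∈ Finset.range (2 * N), ∫ u in x i..x (i + 1), g u := by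
    rw [intervalIntegral.sum_integral_adjacent_intervals
      fun i _ => hg.continuous.intervalIntegrable _ _]
    congr 1
    · simp [x, hN0.ne']
    · simp only [x]
      push_cast
      field_simp
      ring
  rw [hsum, hint, dist_eq_norm, ← Finset.sum_sub_distrib]
  have hterm : ∀ i ∈ Finset.range (2 * N),
      ‖1 / (N : ℝ) * g (x i) - ∫ u in x i..x (i + 1), g u‖ ≤ ε / 4 * (1 / N) := by
    intro i _
    have hc : 1 / (N : ℝ) * g (x i) = ∫ _ in x i..x (i + 1), g (x i) := by
      rw [intervalIntegral.integral_const, hx, smul_eq_mul]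
    rw [hc, ← intervalIntegral.integral_sub intervalIntegrable_const
      (hg.continuous.intervalIntegrable _ _)]
    have hpos : 0 < 1 / (N : ℝ) := by positivity
    refine (intervalIntegral.norm_integral_le_of_norm_le_const (C := ε / 4) fun u hu => ?_).trans_eq
      (by rw [hx, abs_of_pos hpos])
    rw [Set.uIoc_of_le (by linarith [hx i])] at hu
    rw [← dist_eq_norm]
    refine (hgδ ?_).le
    rw [Real.dist_eq, abs_lt]
    constructor <;> linarith [hu.1, hu.2, hx i]
  refine (norm_sum_le_of_le _ hterm).trans_lt ?_
  rw [Finset.sum_const, Finset.card_range, nsmul_eq_mul]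
  push_cast
  field_simp
  linarith

section Zfm

open HaarTrace MvPolynomial IsLoopFunctional

variable {m N : ℕ} {fhat : ℝ → ℝ}

lemma Zfm_sub_eq (hN : N ≠ 0) (U : Matrix.unitaryGroup (Fin N) ℂ) :
    Zfm m N fhat U - (fhat 0 : ℂ) = aeval (powTrace U) (linearForm
      ((Finset.Icc (-⌊2 * (N : ℝ) / m⌋) ⌊2 * (N : ℝ) / m⌋).erase 0)
      fun n => ((1 / N * fhat ((n : ℝ) / N) : ℝ) : ℂ)) := by
  have h0 : (0 : ℤ) ∈ Finset.Icc (-⌊2 * (N : ℝ) / m⌋) ⌊2 * (N : ℝ) / m⌋ := by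
    have : 0 ≤ ⌊2 * (N : ℝ) / m⌋ := Int.floor_nonneg.2 (by positivity)
    simp [this]
  have hN' : (N : ℂ) ≠ 0 := by exact_mod_cast hN
  rw [Zfm, ← Finset.add_sum_erase _ _ h0, linearForm, map_sum]
  simp only [map_smul, aeval_X, powTrace, smul_eq_mul]
  push_cast
  have h1 : (1 / N : ℂ) * fhat 0 * N = fhat 0 := by field_simp
  rw [zpow_zero, OneMemClass.coe_one, Matrix.trace_one, Fintype.card_fin, zero_div,
    h1, add_sub_cancel_left]

lemma sum_eq_sum_Ico (hm : 2 ≤ m) (hN : N ≠ 0) (hcont : Continuous fhat)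
    (hsupp : Function.support fhat ⊆ Set.Icc (-(2 / (m : ℝ))) (2 / (m : ℝ)))
    (heven : ∀ u, fhat (-u) = fhat u) :
    ∑ n ∈ (Finset.Icc (-⌊2 * (N : ℝ) / m⌋) ⌊2 * (N : ℝ) / m⌋).erase 0, (n.natAbs : ℂ) *
      (((1 / N * fhat ((n : ℝ) / N) : ℝ) : ℂ) * ((1 / N * fhat (((-n : ℤ) : ℝ) / N) : ℝ) : ℂ)) =
    ((∑ n ∈ Finset.Ico (-(N : ℤ)) N,
      1 / (N : ℝ) * (|(n : ℝ) / N| * fhat ((n : ℝ) / N) ^ 2) : ℝ) : ℂ) := by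
  have hN0 : (0 : ℝ) < N := by exact_mod_cast Nat.pos_of_ne_zero hN
  have hm0 : (0 : ℝ) < m := by exact_mod_cast (show 0 < m by omega)
  have hm1 : 2 / (m : ℝ) ≤ 1 := by
    rw [div_le_one hm0]
    exact_mod_cast hm
  have hioo : Function.support fhat ⊆ Set.Ioo (-(2 / (m : ℝ))) (2 / (m : ℝ)) := by
    rw [← interior_Icc]
    exact interior_maximal hsupp hcont.isOpen_support
  have hzero : ∀ n : ℤ, fhat ((n : ℝ) / N) ≠ 0 →
      n ∈ Finset.Icc (-⌊2 * (N : ℝ) / m⌋) ⌊2 * (N : ℝ) / m⌋ ∧ n ∈ Finset.Ico (-(N : ℤ)) N := by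
    intro n hn
    obtain ⟨h1, h2⟩ := hioo hn
    rw [lt_div_iff₀ hN0] at h1
    rw [div_lt_iff₀ hN0] at h2
    have h3 : 2 / (m : ℝ) * N ≤ N := mul_le_of_le_one_left hN0.le hm1
    have h4 : 2 * (N : ℝ) / m = 2 / m * N := by ring
    rw [Finset.mem_Icc, Finset.mem_Ico, neg_le, Int.le_floor, Int.le_floor, h4]
    refine ⟨⟨?_, h2.le⟩, ?_, ?_⟩
    · push_cast; linarith
    · have : (-(N : ℝ)) ≤ n := by linarith
      exact_mod_cast this
    · have : (n : ℝ) < N := by linarith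
      exact_mod_cast this
  push_cast
  refine Finset.sum_congr_of_eq_on_inter ?_ ?_ ?_
  · intro n _ hn
    rw [not_imp_comm.1 (fun h => (hzero n h).2) hn]
    simp
  · intro n _ hn
    by_cases h0 : n = 0
    · simp [h0]
    · rw [Finset.mem_erase, not_and] at hn
      rw [not_imp_comm.1 (fun h => (hzero n h).1) (hn h0)]
      simp
  · intro n _ _
    rw [neg_div, heven, abs_div, abs_of_pos hN0, Nat.cast_natAbs, ← Complex.ofReal_intCast |n|, Int.cast_abs]
    push_cast
    ring

lemma integral_Zfm_sub_pow (hm : 2 ≤ m) (hN : N ≠ 0) (hcont : Continuous fhat)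
    (hsupp : Function.support fhat ⊆ Set.Icc (-(2 / (m : ℝ))) (2 / (m : ℝ)))
    (heven : ∀ u, fhat (-u) = fhat u) (μ : Measure (Matrix.unitaryGroup (Fin N) ℂ))
    [IsProbabilityMeasure μ] [μ.IsMulLeftInvariant] :
    ∫ U, (Zfm m N fhat U - (fhat 0 : ℂ)) ^ m ∂μ = if Odd m then 0 else
      (((m.factorial : ℝ) / (2 ^ (m / 2) * (m / 2).factorial) *
        (∑ n ∈ Finset.Ico (-(N : ℤ)) N,
          1 / (N : ℝ) * (|(n : ℝ) / N| * fhat ((n : ℝ) / N) ^ 2)) ^ (m / 2) : ℝ) : ℂ) := by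
  have hm0 : (0 : ℝ) < m := by exact_mod_cast (show 0 < m by omega)
  have hfl : 0 ≤ ⌊2 * (N : ℝ) / m⌋ := Int.floor_nonneg.2 (by positivity)
  have hK : m * ⌊2 * (N : ℝ) / m⌋.toNat ≤ 2 * N := by
    have h := Int.floor_le (2 * (N : ℝ) / m)
    rw [le_div_iff₀ hm0, ← Int.toNat_of_nonneg hfl, mul_comm] at h
    exact_mod_cast h
  simp only [Zfm_sub_eq hN, ← map_pow]
  rw [← expectation_apply, (isLoopFunctional_expectation μ).linearForm_pow
    (by simp [expectation_apply]) (K := ⌊2 * (N : ℝ) / m⌋.toNat) ?_ (Finset.notMem_erase _ _) ?_ m hK,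
    sum_eq_sum_Ico hm hN hcont hsupp heven]
  · push_cast
    rfl
  · intro n hn
    rw [Finset.mem_erase, Finset.mem_Icc] at hn
    omega
  · intro n hn
    rw [Finset.mem_erase, Finset.mem_Icc] at hn ⊢
    omega

end Zfm

lemma fourier_even {f fhat : ℝ → ℝ} (heven : ∀ x, f (-x) = f x)
    (hfourier : ∀ u : ℝ, (fhat u : ℂ) =
      ∫ x : ℝ, (f x : ℂ) * Complex.exp (-(2 * Real.pi * Complex.I) * x * u)) (u : ℝ) :
    fhat (-u) = fhat u := by
  apply Complex.ofReal_injective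
  rw [hfourier, hfourier, ← integral_neg_eq_self]
  refine integral_congr_ae (Eventually.of_forall fun x => ?_)
  simp [heven]

/-- Mock-Gaussian moments in random matrix theory: if `supp f̂ ⊆ [-2/m, 2/m]`, then the `m`-th
centered moment of `Z_f` over `U(N)` with Haar probability measure converges, as `N → ∞`,
to `0` for odd `m` and to `(m!/(2^{m/2}(m/2)!)) σ^m` for even `m`, where
`σ² = ∫_{-1}^{1} |u| f̂(u)² du`. -/
theorem moment_Zf_tendsto (m : ℕ) (hm : 2 ≤ m)
    (μ : ∀ N : ℕ, Measure (Matrix.unitaryGroup (Fin N) ℂ))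
    (hprob : ∀ N, IsProbabilityMeasure (μ N))
    (hinv : ∀ N, (μ N).IsMulLeftInvariant)
    (f fhat : ℝ → ℝ) (heven : ∀ x, f (-x) = f x)
    (hcont : Continuous fhat)
    (hsupp : Function.support fhat ⊆ Set.Icc (-(2 / (m : ℝ))) (2 / (m : ℝ)))
    (hfourier : ∀ u : ℝ, (fhat u : ℂ) =
      ∫ x : ℝ, (f x : ℂ) * Complex.exp (-(2 * Real.pi * Complex.I) * x * u)) :
    Tendsto (fun N : ℕ => ∫ U, (Zfm m N fhat U - (fhat 0 : ℂ)) ^ m ∂(μ N))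
      atTop
      (nhds (if Odd m then 0
        else ((m.factorial : ℝ) / (2 ^ (m / 2) * (m / 2).factorial) *
          (∫ u in (-1 : ℝ)..1, |u| * fhat u ^ 2) ^ (m / 2) : ℝ))) := by
  have hfeven := fourier_even heven hfourier
  have hcs : HasCompactSupport fun u : ℝ => |u| * fhat u ^ 2 :=
    HasCompactSupport.intro isCompact_Icc fun u hu => by
      rw [Function.notMem_support.1 fun h => hu (hsupp h)]
      simp
  have hcg : Continuous fun u : ℝ => |u| * fhat u ^ 2 := continuous_abs.mul (hcont.pow 2)
  have hV := tendsto_sum_Ico_integral (hcs.uniformContinuous_of_continuous hcg)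
  have hev : (fun N : ℕ => if Odd m then 0 else
      (((m.factorial : ℝ) / (2 ^ (m / 2) * (m / 2).factorial) *
        (∑ n ∈ Finset.Ico (-(N : ℤ)) N,
          1 / (N : ℝ) * (|(n : ℝ) / N| * fhat ((n : ℝ) / N) ^ 2)) ^ (m / 2) : ℝ) : ℂ)) =ᶠ[atTop]
      fun N : ℕ => ∫ U, (Zfm m N fhat U - (fhat 0 : ℂ)) ^ m ∂(μ N) := by
    filter_upwards [eventually_ne_atTop 0] with N hN
    have := hprob N
    have := hinv N
    exact (integral_Zfm_sub_pow hm hN hcont hsupp hfeven (μ N)).symm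
  refine Tendsto.congr' hev ?_
  split_ifs
  · exact tendsto_const_nhds
  · exact (Complex.continuous_ofReal.tendsto _).comp ((hV.pow (m / 2)).const_mul _)
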